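/- arXiv:1602.07802 — 8 statements merged into one kernel-verified Lean document; each statement's English description precedes it below -/
import Mathlib

section
/- Under the 1D-FLP data, for every (c, d, z) ∈ Q₁ and every C ⊆ Fin N, the restriction of (c, d, z) to the indices in C belongs to Q₁(C), and hence ∑ over pairs i < j with i, j ∈ C of p i j * d i j ≥ γ(C). Consequently, for every family 𝒞 of subsets of Fin N, the matrix d is feasible for the linear program defining ω(𝒞), and therefore ω(𝒞) ≤ γ*. -/
open Finset

/-- The weighted sum `∑_{i<j, i,j ∈ C} p i j * d i j` over pairs of indices in `C`. -/
noncomputable def pairObj {N : ℕ} (p d : Fin N → Fin N → ℝ) (C : Finset (Fin N)) : ℝ :=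
  ∑ q ∈ (C ×ˢ C).filter (fun q => q.1 < q.2), p q.1 q.2 * d q.1 q.2

/-- Membership in the restricted 1D-FLP feasible set `Q₁(C)`; `Q₁ = Q₁(Finset.univ)`. -/
def Mem1D {N : ℕ} (ℓ : Fin N → ℝ) (L : ℝ) (C : Finset (Fin N))
    (c : Fin N → ℝ) (d z : Fin N → Fin N → ℝ) : Prop :=
  (∀ i ∈ C, ∀ j ∈ C, i ≠ j → d i j = d j i) ∧
  (∀ i ∈ C, ∀ j ∈ C, i ≠ j → d i j ≥ c i - c j) ∧
  (∀ i ∈ C, ∀ j ∈ C, i ≠ j → c i + ℓ i ≤ c j - ℓ j + L * (1 - z i j)) ∧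
  (∀ i ∈ C, ∀ j ∈ C, i ≠ j → z i j + z j i = 1) ∧
  (∀ i ∈ C, 0 ≤ c i ∧ c i ≤ L) ∧
  (∀ i ∈ C, ∀ j ∈ C, i ≠ j → z i j ∈ ({0, 1} : Set ℝ))

/-- `γ(C)`: the optimal (infimum) value of the 1D-FLP restricted to the components `C`. -/
noncomputable def gamma1 {N : ℕ} (ℓ : Fin N → ℝ) (L : ℝ) (p : Fin N → Fin N → ℝ)
    (C : Finset (Fin N)) : ℝ :=
  sInf {v | ∃ c d z, Mem1D ℓ L C c d z ∧ v = pairObj p d C}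

/-- `ω(𝒞)`: the combinatorial dual bound obtained from the family `𝒞`. -/
noncomputable def omega1 {N : ℕ} (ℓ : Fin N → ℝ) (L : ℝ) (p : Fin N → Fin N → ℝ)
    (𝒞 : Set (Finset (Fin N))) : ℝ :=
  sInf {v | ∃ d : Fin N → Fin N → ℝ,
    (∀ i j : Fin N, i ≠ j → d i j = d j i ∧ 0 ≤ d i j) ∧
    (∀ C ∈ 𝒞, pairObj p d C ≥ gamma1 ℓ L p C) ∧
    v = pairObj p d Finset.univ}

theorem Mem1D.mono {N : ℕ} {ℓ : Fin N → ℝ} {L : ℝ} {C C' : Finset (Fin N)} {c : Fin N → ℝ}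
    {d z : Fin N → Fin N → ℝ} (h : Mem1D ℓ L C' c d z) (hC : C ⊆ C') : Mem1D ℓ L C c d z := by
  obtain ⟨h1, h2, h3, h4, h5, h6⟩ := h
  exact ⟨fun i hi j hj => h1 i (hC hi) j (hC hj), fun i hi j hj => h2 i (hC hi) j (hC hj),
    fun i hi j hj => h3 i (hC hi) j (hC hj), fun i hi j hj => h4 i (hC hi) j (hC hj),
    fun i hi => h5 i (hC hi), fun i hi j hj => h6 i (hC hi) j (hC hj)⟩

theorem Mem1D.nonneg {N : ℕ} {ℓ : Fin N → ℝ} {L : ℝ} {C : Finset (Fin N)} {c : Fin N → ℝ}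
    {d z : Fin N → Fin N → ℝ} (h : Mem1D ℓ L C c d z) {i j : Fin N} (hi : i ∈ C) (hj : j ∈ C)
    (hij : i ≠ j) : 0 ≤ d i j := by
  have h1 := h.1 i hi j hj hij
  have h2 := h.2.1 i hi j hj hij
  have h3 := h.2.1 j hj i hi hij.symm
  linarith

theorem pairObj_nonneg {N : ℕ} {p d : Fin N → Fin N → ℝ} {C : Finset (Fin N)}
    (hp : ∀ i j, 0 ≤ p i j) (hd : ∀ i ∈ C, ∀ j ∈ C, i ≠ j → 0 ≤ d i j) : 0 ≤ pairObj p d C := by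
  refine Finset.sum_nonneg fun q hq => ?_
  obtain ⟨hq, hlt⟩ := Finset.mem_filter.mp hq
  obtain ⟨hi, hj⟩ := Finset.mem_product.mp hq
  exact mul_nonneg (hp _ _) (hd _ hi _ hj hlt.ne)

theorem Mem1D.gamma1_le {N : ℕ} {ℓ : Fin N → ℝ} {L : ℝ} {p : Fin N → Fin N → ℝ}
    {C : Finset (Fin N)} {c : Fin N → ℝ} {d z : Fin N → Fin N → ℝ} (h : Mem1D ℓ L C c d z)
    (hp : ∀ i j, 0 ≤ p i j) : gamma1 ℓ L p C ≤ pairObj p d C := by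
  refine csInf_le ⟨0, ?_⟩ ⟨c, d, z, h, rfl⟩
  rintro _ ⟨c', d', z', h', rfl⟩
  exact pairObj_nonneg hp fun i hi j hj hij => h'.nonneg hi hj hij

/-- Proposition 3.1 for the 1D-FLP. -/
theorem oneDFLP_combinatorial_bound {N : ℕ} (hN : 2 ≤ N)
    (ℓ : Fin N → ℝ) (hℓ : ∀ i, 0 < ℓ i)
    (p : Fin N → Fin N → ℝ) (hpsym : ∀ i j, p i j = p j i)
    (hpnn : ∀ i j, 0 ≤ p i j) (hpdiag : ∀ i, p i i = 0)
    (L : ℝ) (hL : L ≥ 2 * ∑ i, ℓ i) :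
    (∀ c d z, Mem1D ℓ L Finset.univ c d z → ∀ C : Finset (Fin N),
      Mem1D ℓ L C c d z ∧ gamma1 ℓ L p C ≤ pairObj p d C) ∧
    (∀ 𝒞 : Set (Finset (Fin N)), ∀ c d z, Mem1D ℓ L Finset.univ c d z →
      ((∀ i j : Fin N, i ≠ j → d i j = d j i ∧ 0 ≤ d i j) ∧
        (∀ C ∈ 𝒞, pairObj p d C ≥ gamma1 ℓ L p C)) ∧
      omega1 ℓ L p 𝒞 ≤ gamma1 ℓ L p Finset.univ) := by
  have restrict : ∀ c d z, Mem1D ℓ L Finset.univ c d z → ∀ C : Finset (Fin N),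
      Mem1D ℓ L C c d z ∧ gamma1 ℓ L p C ≤ pairObj p d C := fun c d z h C =>
    have hC := h.mono (Finset.subset_univ C)
    ⟨hC, hC.gamma1_le hpnn⟩
  have feasible : ∀ 𝒞 : Set (Finset (Fin N)), ∀ c d z, Mem1D ℓ L Finset.univ c d z →
      (∀ i j : Fin N, i ≠ j → d i j = d j i ∧ 0 ≤ d i j) ∧
        (∀ C ∈ 𝒞, pairObj p d C ≥ gamma1 ℓ L p C) := fun 𝒞 c d z h =>
    ⟨fun i j hij => ⟨h.1 i (Finset.mem_univ i) j (Finset.mem_univ j) hij,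
      h.nonneg (Finset.mem_univ i) (Finset.mem_univ j) hij⟩,
      fun C _ => (restrict c d z h C).2⟩
  refine ⟨restrict, fun 𝒞 c d z h => ⟨feasible 𝒞 c d z h, ?_⟩⟩
  refine le_csInf ⟨_, c, d, z, h, rfl⟩ ?_
  rintro _ ⟨c', d', z', h', rfl⟩
  obtain ⟨hd, hC⟩ := feasible 𝒞 c' d' z' h'
  refine csInf_le ⟨0, ?_⟩ ⟨d', hd, hC, rfl⟩
  rintro _ ⟨e, he, -, rfl⟩
  exact pairObj_nonneg hpnn fun i _ j _ hij => (he i j hij).2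
end

section
/- Under the FLP data, for every point of Q₂ and every C ⊆ Fin N, the restriction of the point to the indices in C belongs to Q₂(C), and hence ∑ over pairs i < j with i, j ∈ C of p i j * (dˣ i j + dʸ i j) ≥ γ₂(C). Consequently, for every family 𝒞 of subsets of Fin N, the aggregated matrix (i, j) ↦ dˣ i j + dʸ i j is feasible for the linear program defining ω₂(𝒞), and therefore ω₂(𝒞) ≤ γ₂*. -/
open Finset

/-- Membership in the restricted FLP feasible set `Q₂(C)`; `Q₂ = Q₂(Finset.univ)`. -/
def Mem2D {N : ℕ} (lbx ubx lby uby : Fin N → ℝ) (Lx Ly : ℝ) (α : Fin N → ℝ)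
    (C : Finset (Fin N)) (cx cy lx ly : Fin N → ℝ)
    (dx dy zx zy : Fin N → Fin N → ℝ) : Prop :=
  (∀ i ∈ C, ∀ j ∈ C, i ≠ j → dx i j = dx j i ∧ dy i j = dy j i) ∧
  (∀ i ∈ C, ∀ j ∈ C, i ≠ j → dx i j ≥ cx i - cx j ∧ dy i j ≥ cy i - cy j) ∧
  (∀ i ∈ C, lx i ≤ cx i ∧ cx i ≤ Lx - lx i ∧ ly i ≤ cy i ∧ cy i ≤ Ly - ly i) ∧
  (∀ i ∈ C, 4 * lx i * ly i ≥ α i) ∧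
  (∀ i ∈ C, ∀ j ∈ C, i ≠ j →
    cx i + lx i ≤ cx j - lx j + Lx * (1 - zx i j) ∧
    cy i + ly i ≤ cy j - ly j + Ly * (1 - zy i j)) ∧
  (∀ i ∈ C, ∀ j ∈ C, i ≠ j → zx i j + zx j i + zy i j + zy j i = 1) ∧
  (∀ i ∈ C, lbx i ≤ lx i ∧ lx i ≤ ubx i ∧ lby i ≤ ly i ∧ ly i ≤ uby i) ∧
  (∀ i ∈ C, ∀ j ∈ C, i ≠ j →
    zx i j ∈ ({0, 1} : Set ℝ) ∧ zy i j ∈ ({0, 1} : Set ℝ))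

/-- `γ₂(C)`: the optimal (infimum) value of the FLP restricted to the components `C`. -/
noncomputable def gamma2 {N : ℕ} (lbx ubx lby uby : Fin N → ℝ) (Lx Ly : ℝ)
    (α : Fin N → ℝ) (p : Fin N → Fin N → ℝ) (C : Finset (Fin N)) : ℝ :=
  sInf {v | ∃ cx cy lx ly dx dy zx zy,
    Mem2D lbx ubx lby uby Lx Ly α C cx cy lx ly dx dy zx zy ∧
    v = pairObj p (fun i j => dx i j + dy i j) C}

/-- `ω₂(𝒞)`: the combinatorial dual bound for the FLP obtained from the family `𝒞`. -/
noncomputable def omega2 {N : ℕ} (lbx ubx lby uby : Fin N → ℝ) (Lx Ly : ℝ)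
    (α : Fin N → ℝ) (p : Fin N → Fin N → ℝ) (𝒞 : Set (Finset (Fin N))) : ℝ :=
  sInf {v | ∃ d : Fin N → Fin N → ℝ,
    (∀ i j : Fin N, i ≠ j → d i j = d j i ∧ 0 ≤ d i j) ∧
    (∀ C ∈ 𝒞, pairObj p d C ≥ gamma2 lbx ubx lby uby Lx Ly α p C) ∧
    v = pairObj p d Finset.univ}

section Mem2D

variable {N : ℕ} {lbx ubx lby uby : Fin N → ℝ} {Lx Ly : ℝ} {α : Fin N → ℝ}
  {C D : Finset (Fin N)} {cx cy lx ly : Fin N → ℝ} {dx dy zx zy : Fin N → Fin N → ℝ}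

theorem Mem2D.mono (h : Mem2D lbx ubx lby uby Lx Ly α D cx cy lx ly dx dy zx zy)
    (hCD : C ⊆ D) : Mem2D lbx ubx lby uby Lx Ly α C cx cy lx ly dx dy zx zy := by
  obtain ⟨hsymm, hdist, hfloor, harea, hsep, hone, hbound, hbin⟩ := h
  exact ⟨fun i hi j hj => hsymm i (hCD hi) j (hCD hj),
    fun i hi j hj => hdist i (hCD hi) j (hCD hj),
    fun i hi => hfloor i (hCD hi),
    fun i hi => harea i (hCD hi),
    fun i hi j hj => hsep i (hCD hi) j (hCD hj),
    fun i hi j hj => hone i (hCD hi) j (hCD hj),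
    fun i hi => hbound i (hCD hi),
    fun i hi j hj => hbin i (hCD hi) j (hCD hj)⟩

theorem Mem2D.dist_symm (h : Mem2D lbx ubx lby uby Lx Ly α C cx cy lx ly dx dy zx zy)
    {i j : Fin N} (hi : i ∈ C) (hj : j ∈ C) (hij : i ≠ j) :
    dx i j + dy i j = dx j i + dy j i := by
  obtain ⟨hx, hy⟩ := h.1 i hi j hj hij
  rw [hx, hy]

theorem Mem2D.dist_nonneg (h : Mem2D lbx ubx lby uby Lx Ly α C cx cy lx ly dx dy zx zy)
    {i j : Fin N} (hi : i ∈ C) (hj : j ∈ C) (hij : i ≠ j) : 0 ≤ dx i j + dy i j := by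
  have hsymm := h.1 i hi j hj hij
  have h₁ := h.2.1 i hi j hj hij
  have h₂ := h.2.1 j hj i hi hij.symm
  linarith [hsymm.1, hsymm.2, h₁.1, h₁.2, h₂.1, h₂.2]

theorem Mem2D.gamma2_le {p : Fin N → Fin N → ℝ} (hp : ∀ i j, 0 ≤ p i j)
    (h : Mem2D lbx ubx lby uby Lx Ly α C cx cy lx ly dx dy zx zy) :
    gamma2 lbx ubx lby uby Lx Ly α p C ≤ pairObj p (fun i j => dx i j + dy i j) C := by
  refine csInf_le ⟨0, ?_⟩ ⟨cx, cy, lx, ly, dx, dy, zx, zy, h, rfl⟩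
  rintro _ ⟨_, _, _, _, _, _, _, _, h', rfl⟩
  exact pairObj_nonneg hp fun i hi j hj hij => h'.dist_nonneg hi hj hij

theorem Mem2D.omega2_le {p : Fin N → Fin N → ℝ} (hp : ∀ i j, 0 ≤ p i j)
    (𝒞 : Set (Finset (Fin N)))
    (h : Mem2D lbx ubx lby uby Lx Ly α Finset.univ cx cy lx ly dx dy zx zy) :
    omega2 lbx ubx lby uby Lx Ly α p 𝒞
      ≤ pairObj p (fun i j => dx i j + dy i j) Finset.univ := by
  refine csInf_le ⟨0, ?_⟩ ⟨fun i j => dx i j + dy i j, fun i j hij =>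
    ⟨h.dist_symm (Finset.mem_univ i) (Finset.mem_univ j) hij,
      h.dist_nonneg (Finset.mem_univ i) (Finset.mem_univ j) hij⟩,
    fun C _ => (h.mono (Finset.subset_univ C)).gamma2_le hp, rfl⟩
  rintro _ ⟨d, hd, _, rfl⟩
  exact pairObj_nonneg hp fun i _ j _ hij => (hd i j hij).2

end Mem2D

/-- Proposition 3.1 for the two-dimensional FLP. -/
theorem FLP_combinatorial_bound {N : ℕ} (hN : 2 ≤ N)
    (lbx ubx lby uby : Fin N → ℝ)
    (hlbx : ∀ i, 0 < lbx i) (hbx : ∀ i, lbx i ≤ ubx i)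
    (hlby : ∀ i, 0 < lby i) (hby : ∀ i, lby i ≤ uby i)
    (Lx Ly : ℝ) (hLx : Lx ≥ 2 * ∑ i, ubx i) (hLy : Ly ≥ 2 * ∑ i, uby i)
    (α : Fin N → ℝ) (hα : ∀ i, 0 < α i) (harea : ∀ i, 4 * ubx i * uby i ≥ α i)
    (p : Fin N → Fin N → ℝ) (hpsym : ∀ i j, p i j = p j i)
    (hpnn : ∀ i j, 0 ≤ p i j) (hpdiag : ∀ i, p i i = 0) :
    (∀ cx cy lx ly dx dy zx zy,
      Mem2D lbx ubx lby uby Lx Ly α Finset.univ cx cy lx ly dx dy zx zy →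
      ∀ C : Finset (Fin N),
        Mem2D lbx ubx lby uby Lx Ly α C cx cy lx ly dx dy zx zy ∧
        gamma2 lbx ubx lby uby Lx Ly α p C ≤ pairObj p (fun i j => dx i j + dy i j) C) ∧
    (∀ 𝒞 : Set (Finset (Fin N)), ∀ cx cy lx ly dx dy zx zy,
      Mem2D lbx ubx lby uby Lx Ly α Finset.univ cx cy lx ly dx dy zx zy →
      ((∀ i j : Fin N, i ≠ j →
          (fun i j => dx i j + dy i j) i j = (fun i j => dx i j + dy i j) j i ∧
          0 ≤ (fun i j => dx i j + dy i j) i j) ∧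
        (∀ C ∈ 𝒞, pairObj p (fun i j => dx i j + dy i j) C
          ≥ gamma2 lbx ubx lby uby Lx Ly α p C)) ∧
      omega2 lbx ubx lby uby Lx Ly α p 𝒞
        ≤ gamma2 lbx ubx lby uby Lx Ly α p Finset.univ) := by
  refine ⟨fun cx cy lx ly dx dy zx zy h C => ?_, fun 𝒞 cx cy lx ly dx dy zx zy h => ?_⟩
  · have hC := h.mono (Finset.subset_univ C)
    exact ⟨hC, hC.gamma2_le hpnn⟩
  · refine ⟨⟨fun i j hij => ⟨h.dist_symm (Finset.mem_univ i) (Finset.mem_univ j) hij,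
      h.dist_nonneg (Finset.mem_univ i) (Finset.mem_univ j) hij⟩,
      fun C _ => (h.mono (Finset.subset_univ C)).gamma2_le hpnn⟩, ?_⟩
    refine le_csInf ⟨_, cx, cy, lx, ly, dx, dy, zx, zy, h, rfl⟩ ?_
    rintro _ ⟨_, _, _, _, _, _, _, _, h', rfl⟩
    exact h'.omega2_le hpnn 𝒞
end

section
/- Under the 1D-FLP data, for every pair of distinct indices i, j ∈ Fin N, the infimum of d i j over the two-component restricted feasible set Q₁({i, j}) equals ℓ i + ℓ j, and this infimum is attained. Consequently γ({i, j}) = p i j * (ℓ i + ℓ j). -/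
open Finset

/-- The separation constraint forces a distance of at least `ℓ i + ℓ j`. -/
theorem Mem1D.add_le_dist {N : ℕ} {ℓ : Fin N → ℝ} {L : ℝ} {i j : Fin N} (hij : i ≠ j)
    {c : Fin N → ℝ} {d z : Fin N → Fin N → ℝ} (h : Mem1D ℓ L {i, j} c d z) :
    ℓ i + ℓ j ≤ d i j := by
  obtain ⟨hsymm, hdist, hsep, hsum, -, hbin⟩ := h
  have hi : i ∈ ({i, j} : Finset (Fin N)) := by simp
  have hj : j ∈ ({i, j} : Finset (Fin N)) := by simp
  have hs := hsum i hi j hj hij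
  have hsep₁ := hsep i hi j hj hij
  have hsep₂ := hsep j hj i hi hij.symm
  have hd₁ := hdist i hi j hj hij
  have hd₂ := hdist j hj i hi hij.symm
  rw [← hsymm i hi j hj hij] at hd₂
  rcases hbin i hi j hj hij with hz | hz
  · have hz' : z j i = 1 := by linarith
    rw [hz'] at hsep₂
    linarith
  · rw [Set.mem_singleton_iff.mp hz] at hsep₁
    linarith

/-- Placing `i` at the origin with `j` adjacent to it is feasible. -/
theorem mem1D_adjacent {N : ℕ} {ℓ : Fin N → ℝ} (hℓ : ∀ i, 0 < ℓ i) {L : ℝ}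
    (hL : L ≥ 2 * ∑ i, ℓ i) {i j : Fin N} (hij : i ≠ j) :
    Mem1D ℓ L {i, j} (fun a => if a = i then 0 else ℓ i + ℓ j) (fun _ _ => ℓ i + ℓ j)
      (fun a _ => if a = i then 1 else 0) := by
  have hle : ℓ i + ℓ j ≤ ∑ k, ℓ k := by
    rw [← Finset.sum_pair hij]
    exact Finset.sum_le_sum_of_subset_of_nonneg (Finset.subset_univ _)
      fun k _ _ => (hℓ k).le
  have hi := hℓ i
  have hj := hℓ j
  refine ⟨?_, ?_, ?_, ?_, ?_, ?_⟩ <;>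
    simp [hij, hij.symm] <;> (repeat' apply And.intro) <;> linarith

/-- The objective on two components is the single term `p i j * d i j`. -/
theorem pairObj_pair {N : ℕ} {p d : Fin N → Fin N → ℝ} {i j : Fin N} (hij : i ≠ j)
    (hp : p i j = p j i) (hd : d i j = d j i) :
    pairObj p d {i, j} = p i j * d i j := by
  unfold pairObj
  rcases lt_or_gt_of_ne hij with h | h
  · have : (({i, j} ×ˢ {i, j} : Finset (Fin N × Fin N)).filter (fun q => q.1 < q.2))
        = {(i, j)} := by
      ext ⟨a, b⟩
      simp only [mem_filter, mem_product, mem_insert, mem_singleton, Prod.mk.injEq]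
      grind
    rw [this, sum_singleton]
  · have : (({i, j} ×ˢ {i, j} : Finset (Fin N × Fin N)).filter (fun q => q.1 < q.2))
        = {(j, i)} := by
      ext ⟨a, b⟩
      simp only [mem_filter, mem_product, mem_insert, mem_singleton, Prod.mk.injEq]
      grind
    rw [this, sum_singleton, hp, hd]

/-- closed form of the level-2 partial bounds for the 1D-FLP. -/
theorem oneDFLP_pair_bound_closed_form {N : ℕ} (hN : 2 ≤ N)
    (ℓ : Fin N → ℝ) (hℓ : ∀ i, 0 < ℓ i)
    (p : Fin N → Fin N → ℝ) (hpsym : ∀ i j, p i j = p j i)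
    (hpnn : ∀ i j, 0 ≤ p i j) (hpdiag : ∀ i, p i i = 0)
    (L : ℝ) (hL : L ≥ 2 * ∑ i, ℓ i)
    (i j : Fin N) (hij : i ≠ j) :
    IsLeast {v | ∃ c d z, Mem1D ℓ L {i, j} c d z ∧ v = d i j} (ℓ i + ℓ j) ∧
    gamma1 ℓ L p {i, j} = p i j * (ℓ i + ℓ j) := by
  refine ⟨⟨⟨_, _, _, mem1D_adjacent hℓ hL hij, rfl⟩, ?_⟩, IsLeast.csInf_eq ⟨?_, ?_⟩⟩
  · rintro v ⟨c, d, z, h, rfl⟩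
    exact h.add_le_dist hij
  · exact ⟨_, _, _, mem1D_adjacent hℓ hL hij, by rw [pairObj_pair hij (hpsym i j) rfl]⟩
  · rintro v ⟨c, d, z, h, rfl⟩
    rw [pairObj_pair hij (hpsym i j) (h.1 i (by simp) j (by simp) hij)]
    exact mul_le_mul_of_nonneg_left (h.add_le_dist hij) (hpnn i j)
end

section
/- Under the FLP data, suppose additionally that 4 * lbˣ k * ubʸ k ≥ α k and 4 * lbʸ k * ubˣ k ≥ α k for k ∈ {i, j}, where i, j ∈ Fin N are distinct. Then the infimum of dˣ i j + dʸ i j over the two-component restricted feasible set Q₂({i, j}) equals min (lbˣ i + lbˣ j) (lbʸ i + lbʸ j), and this infimum is attained. Consequently γ₂({i, j}) = p i j * min (lbˣ i + lbˣ j) (lbʸ i + lbʸ j). -/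
open Finset

/-- The feasible set is invariant under exchanging the two directions. -/
theorem Mem2D.swap {N : ℕ} {lbx ubx lby uby : Fin N → ℝ} {Lx Ly : ℝ} {α : Fin N → ℝ}
    {C : Finset (Fin N)} {cx cy lx ly : Fin N → ℝ} {dx dy zx zy : Fin N → Fin N → ℝ}
    (h : Mem2D lbx ubx lby uby Lx Ly α C cx cy lx ly dx dy zx zy) :
    Mem2D lby uby lbx ubx Ly Lx α C cy cx ly lx dy dx zy zx := by
  obtain ⟨hsymm, hdist, hbox, harea, hsep, hsum, hlen, hbin⟩ := h
  refine ⟨fun i hi j hj hij => (hsymm i hi j hj hij).symm,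
    fun i hi j hj hij => (hdist i hi j hj hij).symm, fun i hi => ?_, fun i hi => ?_,
    fun i hi j hj hij => (hsep i hi j hj hij).symm, fun i hi j hj hij => ?_, fun i hi => ?_,
    fun i hi j hj hij => (hbin i hi j hj hij).symm⟩
  · obtain ⟨h₁, h₂, h₃, h₄⟩ := hbox i hi
    exact ⟨h₃, h₄, h₁, h₂⟩
  · linarith [harea i hi, mul_right_comm 4 (lx i) (ly i)]
  · linarith [hsum i hi j hj hij]
  · obtain ⟨h₁, h₂, h₃, h₄⟩ := hlen i hi
    exact ⟨h₃, h₄, h₁, h₂⟩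

/-- Two components can be placed next to each other in the first direction, at their minimal
widths, with equal coordinates in the second direction. -/
theorem exists_mem2D_pair {N : ℕ} {lbx ubx lby uby : Fin N → ℝ}
    (hlbx : ∀ i, 0 < lbx i) (hbx : ∀ i, lbx i ≤ ubx i)
    (hlby : ∀ i, 0 < lby i) (hby : ∀ i, lby i ≤ uby i)
    {Lx Ly : ℝ} (hLx : Lx ≥ 2 * ∑ i, ubx i) (hLy : Ly ≥ 2 * ∑ i, uby i)
    {α : Fin N → ℝ} {i j : Fin N} (hij : i ≠ j)
    (hi : 4 * lbx i * uby i ≥ α i) (hj : 4 * lbx j * uby j ≥ α j) :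
    ∃ cx cy lx ly dx dy zx zy,
      Mem2D lbx ubx lby uby Lx Ly α {i, j} cx cy lx ly dx dy zx zy ∧
      lbx i + lbx j = dx i j + dy i j := by
  have hpair : ∀ u : Fin N → ℝ, (∀ k, 0 ≤ u k) → u i + u j ≤ ∑ k, u k := fun u hu => by
    rw [← sum_pair hij]
    exact sum_le_sum_of_subset_of_nonneg (subset_univ _) fun k _ _ => hu k
  have hx := hpair ubx fun k => (hlbx k).le.trans (hbx k)
  have hy := hpair uby fun k => (hlby k).le.trans (hby k)
  have := hlbx i
  have := hlbx j
  have := hlby i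
  have := hlby j
  have := hbx i
  have := hbx j
  have := hby i
  have := hby j
  refine ⟨fun k => if k = i then lbx i else 2 * lbx i + lbx j, fun _ => Ly / 2, lbx, uby,
    fun _ _ => lbx i + lbx j, fun _ _ => 0, fun k _ => if k = i then 1 else 0, fun _ _ => 0,
    ?_, by simp⟩
  simp only [Mem2D, mem_insert, mem_singleton, forall_eq_or_imp, forall_eq, hij, hij.symm,
    ne_eq, not_true_eq_false, not_false_eq_true, if_true, if_false, false_imp_iff,
    true_imp_iff, true_and, and_true, Set.mem_insert_iff, Set.mem_singleton_iff]
  refine ⟨?_, ?_, ?_, ?_, ?_, ?_, ?_⟩ <;> norm_num <;>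
    (repeat' apply And.intro) <;> linarith

/-- In one direction, a distance variable of a pair is nonnegative, and it is at least the sum of
the minimal half-widths when the pair is separated in that direction. -/
theorem pair_dist_bounds {ci cj li lj bi bj L d zij zji : ℝ}
    (hd : d ≥ ci - cj) (hd' : d ≥ cj - ci)
    (hsep : ci + li ≤ cj - lj + L * (1 - zij)) (hsep' : cj + lj ≤ ci - li + L * (1 - zji))
    (hli : bi ≤ li) (hlj : bj ≤ lj) :
    0 ≤ d ∧ (zij = 1 ∨ zji = 1 → bi + bj ≤ d) := by
  refine ⟨by linarith, ?_⟩
  rintro (rfl | rfl) <;> linarith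

theorem Mem2D.min_le_dist {N : ℕ} {lbx ubx lby uby : Fin N → ℝ} {Lx Ly : ℝ} {α : Fin N → ℝ}
    {i j : Fin N} (hij : i ≠ j)
    {cx cy lx ly : Fin N → ℝ} {dx dy zx zy : Fin N → Fin N → ℝ}
    (h : Mem2D lbx ubx lby uby Lx Ly α {i, j} cx cy lx ly dx dy zx zy) :
    min (lbx i + lbx j) (lby i + lby j) ≤ dx i j + dy i j := by
  obtain ⟨hsymm, hdist, -, -, hsep, hsum, hlen, hbin⟩ := h
  have hi : i ∈ ({i, j} : Finset (Fin N)) := mem_insert_self i {j}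
  have hj : j ∈ ({i, j} : Finset (Fin N)) := mem_insert_of_mem (mem_singleton_self j)
  have hs := hsymm i hi j hj hij
  have hd := hdist i hi j hj hij
  have hd' := hdist j hj i hi hij.symm
  rw [← hs.1, ← hs.2] at hd'
  have hsep₁ := hsep i hi j hj hij
  have hsep₂ := hsep j hj i hi hij.symm
  obtain ⟨hli, -, hmi, -⟩ := hlen i hi
  obtain ⟨hlj, -, hmj, -⟩ := hlen j hj
  obtain ⟨hx₀, hx⟩ := pair_dist_bounds hd.1 hd'.1 hsep₁.1 hsep₂.1 hli hlj
  obtain ⟨hy₀, hy⟩ := pair_dist_bounds hd.2 hd'.2 hsep₁.2 hsep₂.2 hmi hmj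
  have hz := hsum i hi j hj hij
  have hbin₁ := hbin i hi j hj hij
  have hbin₂ := hbin j hj i hi hij.symm
  simp only [Set.mem_insert_iff, Set.mem_singleton_iff] at hbin₁ hbin₂
  have hone : (zx i j = 1 ∨ zx j i = 1) ∨ (zy i j = 1 ∨ zy j i = 1) := by
    by_contra! hne
    rw [hbin₁.1.resolve_right hne.1.1, hbin₂.1.resolve_right hne.1.2,
      hbin₁.2.resolve_right hne.2.1, hbin₂.2.resolve_right hne.2.2] at hz
    norm_num at hz
  rcases hone with hone | hone
  · exact (min_le_left _ _).trans (by linarith [hx hone])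
  · exact (min_le_right _ _).trans (by linarith [hy hone])

/-- closed form of the level-2 partial bounds for the FLP. -/
theorem FLP_pair_bound_closed_form {N : ℕ} (hN : 2 ≤ N)
    (lbx ubx lby uby : Fin N → ℝ)
    (hlbx : ∀ i, 0 < lbx i) (hbx : ∀ i, lbx i ≤ ubx i)
    (hlby : ∀ i, 0 < lby i) (hby : ∀ i, lby i ≤ uby i)
    (Lx Ly : ℝ) (hLx : Lx ≥ 2 * ∑ i, ubx i) (hLy : Ly ≥ 2 * ∑ i, uby i)
    (α : Fin N → ℝ) (hα : ∀ i, 0 < α i)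
    (p : Fin N → Fin N → ℝ) (hpsym : ∀ i j, p i j = p j i)
    (hpnn : ∀ i j, 0 ≤ p i j) (hpdiag : ∀ i, p i i = 0)
    (i j : Fin N) (hij : i ≠ j)
    (hxyi : 4 * lbx i * uby i ≥ α i) (hxyj : 4 * lbx j * uby j ≥ α j)
    (hyxi : 4 * lby i * ubx i ≥ α i) (hyxj : 4 * lby j * ubx j ≥ α j) :
    IsLeast {v | ∃ cx cy lx ly dx dy zx zy,
        Mem2D lbx ubx lby uby Lx Ly α {i, j} cx cy lx ly dx dy zx zy ∧
        v = dx i j + dy i j}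
      (min (lbx i + lbx j) (lby i + lby j)) ∧
    gamma2 lbx ubx lby uby Lx Ly α p {i, j}
      = p i j * min (lbx i + lbx j) (lby i + lby j) := by
  have hleast : IsLeast {v | ∃ cx cy lx ly dx dy zx zy,
      Mem2D lbx ubx lby uby Lx Ly α {i, j} cx cy lx ly dx dy zx zy ∧
      v = dx i j + dy i j}
      (min (lbx i + lbx j) (lby i + lby j)) := by
    refine ⟨?_, ?_⟩
    · rcases min_choice (lbx i + lbx j) (lby i + lby j) with h | h <;> rw [h]
      · exact exists_mem2D_pair hlbx hbx hlby hby hLx hLy hij hxyi hxyj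
      · obtain ⟨cy, cx, ly, lx, dy, dx, zy, zx, hmem, hval⟩ :=
          exists_mem2D_pair hlby hby hlbx hbx hLy hLx hij hyxi hyxj
        exact ⟨cx, cy, lx, ly, dx, dy, zx, zy, hmem.swap, hval.trans (add_comm _ _)⟩
    · rintro v ⟨cx, cy, lx, ly, dx, dy, zx, zy, hmem, rfl⟩
      exact hmem.min_le_dist hij
  refine ⟨hleast, ?_⟩
  have hobj : ∀ {cx cy lx ly : Fin N → ℝ} {dx dy zx zy : Fin N → Fin N → ℝ},
      Mem2D lbx ubx lby uby Lx Ly α {i, j} cx cy lx ly dx dy zx zy →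
      pairObj p (fun i j => dx i j + dy i j) {i, j} = p i j * (dx i j + dy i j) := by
    intro cx cy lx ly dx dy zx zy hmem
    obtain ⟨hdx, hdy⟩ := hmem.1 i (by simp) j (by simp) hij
    exact pairObj_pair hij (hpsym i j) (by simp only [hdx, hdy])
  refine IsLeast.csInf_eq ⟨?_, ?_⟩
  · obtain ⟨cx, cy, lx, ly, dx, dy, zx, zy, hmem, hval⟩ := hleast.1
    exact ⟨cx, cy, lx, ly, dx, dy, zx, zy, hmem, by rw [hobj hmem, hval]⟩
  · rintro v ⟨cx, cy, lx, ly, dx, dy, zx, zy, hmem, rfl⟩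
    rw [hobj hmem]
    exact mul_le_mul_of_nonneg_left (hmem.min_le_dist hij) (hpnn i j)
end

section
/- Under the 1D-FLP data, the infimum of the objective f over the set Q₁ᴸᴾ ∩ {(c, d, z) : d i j ≥ ℓ i + ℓ j for all i ≠ j} equals ∑ over pairs i < j of p i j * (ℓ i + ℓ j), and it is attained at the point with ĉ i = L / 2, d̂ i j = ℓ i + ℓ j, and ẑ i j = 1 / 2. -/
open Finset

/-- Membership in the LP relaxation `Q₁ᴸᴾ` of the 1D-FLP formulation. -/
def Mem1DLP {N : ℕ} (ℓ : Fin N → ℝ) (L : ℝ)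
    (c : Fin N → ℝ) (d z : Fin N → Fin N → ℝ) : Prop :=
  (∀ i j : Fin N, i ≠ j → d i j = d j i) ∧
  (∀ i j : Fin N, i ≠ j → d i j ≥ c i - c j) ∧
  (∀ i j : Fin N, i ≠ j → c i + ℓ i ≤ c j - ℓ j + L * (1 - z i j)) ∧
  (∀ i j : Fin N, i ≠ j → z i j + z j i = 1) ∧
  (∀ i : Fin N, 0 ≤ c i ∧ c i ≤ L) ∧
  (∀ i j : Fin N, i ≠ j → 0 ≤ z i j ∧ z i j ≤ 1)

theorem pairObj_mono {N : ℕ} {p d e : Fin N → Fin N → ℝ} (hp : ∀ i j, 0 ≤ p i j)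
    (h : ∀ i j, i ≠ j → d i j ≤ e i j) (C : Finset (Fin N)) :
    pairObj p d C ≤ pairObj p e C := by
  refine Finset.sum_le_sum fun q hq => mul_le_mul_of_nonneg_left ?_ (hp _ _)
  exact h _ _ (Finset.mem_filter.mp hq).2.ne

theorem mem1DLP_midpoint {N : ℕ} {ℓ : Fin N → ℝ} (hℓ : ∀ i, 0 ≤ ℓ i) {L : ℝ}
    (hL : 2 * ∑ i, ℓ i ≤ L) :
    Mem1DLP ℓ L (fun _ => L / 2) (fun i j => ℓ i + ℓ j) (fun _ _ => 1 / 2) := by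
  have hsum : 0 ≤ ∑ i, ℓ i := Finset.sum_nonneg fun i _ => hℓ i
  refine ⟨fun i j _ => add_comm _ _, fun i j _ => ?_, fun i j hij => ?_, fun i j _ => ?_,
    fun i => ⟨?_, ?_⟩, fun i j _ => ?_⟩
  · linarith [hℓ i, hℓ j]
  · have hpair : ℓ i + ℓ j ≤ ∑ k, ℓ k :=
      Finset.add_le_sum (fun k _ => hℓ k) (Finset.mem_univ i) (Finset.mem_univ j) hij
    linarith
  · norm_num
  · linarith
  · linarith
  · norm_num

/-- with the objective cuts `d i j ≥ ℓ i + ℓ j`, the LP relaxation value of the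
1D-FLP equals the level-2 combinatorial bound `ω₂ = ∑_{i<j} p i j * (ℓ i + ℓ j)`, attained at
the point `ĉ i = L/2`, `d̂ i j = ℓ i + ℓ j`, `ẑ i j = 1/2`. -/
theorem oneDFLP_LP_with_cuts_value {N : ℕ} (hN : 2 ≤ N)
    (ℓ : Fin N → ℝ) (hℓ : ∀ i, 0 < ℓ i)
    (p : Fin N → Fin N → ℝ) (hpsym : ∀ i j, p i j = p j i)
    (hpnn : ∀ i j, 0 ≤ p i j) (hpdiag : ∀ i, p i i = 0)
    (L : ℝ) (hL : L ≥ 2 * ∑ i, ℓ i) :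
    Mem1DLP ℓ L (fun _ => L / 2) (fun i j => ℓ i + ℓ j) (fun _ _ => 1 / 2) ∧
    IsLeast {v | ∃ c d z, Mem1DLP ℓ L c d z ∧ (∀ i j : Fin N, i ≠ j → d i j ≥ ℓ i + ℓ j) ∧
        v = pairObj p d Finset.univ}
      (pairObj p (fun i j => ℓ i + ℓ j) Finset.univ) := by
  have hmid := mem1DLP_midpoint (fun i => (hℓ i).le) hL
  refine ⟨hmid, ⟨_, _, _, hmid, fun _ _ _ => le_rfl, rfl⟩, ?_⟩
  rintro v ⟨c, d, z, -, hcut, rfl⟩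
  exact pairObj_mono hpnn hcut Finset.univ
end

section
/- Under the FLP data, suppose additionally that ubˢ i ≥ Real.sqrt (α i) for all i and s ∈ {x, y}. Then the infimum of the objective over the set Q₂ᴸᴾ ∩ {points : dˣ i j + dʸ i j ≥ min (lbˣ i + lbˣ j) (lbʸ i + lbʸ j) for all i ≠ j} equals ∑ over pairs i < j of p i j * min (lbˣ i + lbˣ j) (lbʸ i + lbʸ j), and this infimum is attained. -/
open Finset

/-- Membership in the LP relaxation `Q₂ᴸᴾ` of the FLP formulation. -/
def Mem2DLP {N : ℕ} (lbx ubx lby uby : Fin N → ℝ) (Lx Ly : ℝ) (α : Fin N → ℝ)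
    (cx cy lx ly : Fin N → ℝ) (dx dy zx zy : Fin N → Fin N → ℝ) : Prop :=
  (∀ i j : Fin N, i ≠ j → dx i j = dx j i ∧ dy i j = dy j i) ∧
  (∀ i j : Fin N, i ≠ j → dx i j ≥ cx i - cx j ∧ dy i j ≥ cy i - cy j) ∧
  (∀ i : Fin N, lx i ≤ cx i ∧ cx i ≤ Lx - lx i ∧ ly i ≤ cy i ∧ cy i ≤ Ly - ly i) ∧
  (∀ i : Fin N, 4 * lx i * ly i ≥ α i) ∧
  (∀ i j : Fin N, i ≠ j →
    cx i + lx i ≤ cx j - lx j + Lx * (1 - zx i j) ∧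
    cy i + ly i ≤ cy j - ly j + Ly * (1 - zy i j)) ∧
  (∀ i j : Fin N, i ≠ j → zx i j + zx j i + zy i j + zy j i = 1) ∧
  (∀ i : Fin N, lbx i ≤ lx i ∧ lx i ≤ ubx i ∧ lby i ≤ ly i ∧ ly i ≤ uby i) ∧
  (∀ i j : Fin N, i ≠ j →
    (0 ≤ zx i j ∧ zx i j ≤ 1) ∧ (0 ≤ zy i j ∧ zy i j ≤ 1))

/-- with the valid inequalities
`dˣ i j + dʸ i j ≥ min (lbˣ i + lbˣ j) (lbʸ i + lbʸ j)`, the LP relaxation value of the FLP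
equals the level-2 combinatorial bound `ω₂ = ∑_{i<j} p i j * min (lbˣ i + lbˣ j) (lbʸ i + lbʸ j)`,
and this infimum is attained. -/
theorem FLP_LP_with_cuts_value {N : ℕ} (hN : 2 ≤ N)
    (lbx ubx lby uby : Fin N → ℝ)
    (hlbx : ∀ i, 0 < lbx i) (hbx : ∀ i, lbx i ≤ ubx i)
    (hlby : ∀ i, 0 < lby i) (hby : ∀ i, lby i ≤ uby i)
    (Lx Ly : ℝ) (hLx : Lx ≥ 2 * ∑ i, ubx i) (hLy : Ly ≥ 2 * ∑ i, uby i)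
    (α : Fin N → ℝ) (hα : ∀ i, 0 < α i)
    (p : Fin N → Fin N → ℝ) (hpsym : ∀ i j, p i j = p j i)
    (hpnn : ∀ i j, 0 ≤ p i j) (hpdiag : ∀ i, p i i = 0)
    (hub : ∀ i, ubx i ≥ Real.sqrt (α i) ∧ uby i ≥ Real.sqrt (α i)) :
    IsLeast {v | ∃ cx cy lx ly dx dy zx zy,
        Mem2DLP lbx ubx lby uby Lx Ly α cx cy lx ly dx dy zx zy ∧
        (∀ i j : Fin N, i ≠ j →
          dx i j + dy i j ≥ min (lbx i + lbx j) (lby i + lby j)) ∧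
        v = pairObj p (fun i j => dx i j + dy i j) Finset.univ}
      (pairObj p (fun i j => min (lbx i + lbx j) (lby i + lby j)) Finset.univ) := by
  have hposx : ∀ i, 0 < ubx i := fun i => (hlbx i).trans_le (hbx i)
  have hposy : ∀ i, 0 < uby i := fun i => (hlby i).trans_le (hby i)
  have hsx : ∀ i, ubx i ≤ ∑ k, ubx k := fun i =>
    Finset.single_le_sum (fun k _ => (hposx k).le) (Finset.mem_univ i)
  have hsy : ∀ i, uby i ≤ ∑ k, uby k := fun i =>
    Finset.single_le_sum (fun k _ => (hposy k).le) (Finset.mem_univ i)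
  have hmin : ∀ i j, 0 ≤ min (lbx i + lbx j) (lby i + lby j) := fun i j =>
    le_min (add_pos (hlbx i) (hlbx j)).le (add_pos (hlby i) (hlby j)).le
  constructor
  · refine ⟨fun _ => Lx / 2, fun _ => Ly / 2, ubx, uby,
      fun i j => min (lbx i + lbx j) (lby i + lby j), fun _ _ => 0,
      fun _ _ => 1 / 4, fun _ _ => 1 / 4, ⟨?_, ?_, ?_, ?_, ?_, ?_, ?_, ?_⟩, ?_, ?_⟩
    · intro i j _
      simp only [add_comm, and_self]
    · intro i j _
      simpa using hmin i j
    · intro i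
      have := hsx i
      have := hsy i
      refine ⟨?_, ?_, ?_, ?_⟩ <;> linarith
    · intro i
      have h : √(α i) * √(α i) ≤ ubx i * uby i :=
        mul_le_mul (hub i).1 (hub i).2 (Real.sqrt_nonneg _) (hposx i).le
      rw [Real.mul_self_sqrt (hα i).le] at h
      linarith [hα i]
    · intro i j hij
      have hx := add_le_sum (fun k _ => (hposx k).le) (mem_univ i) (mem_univ j) hij
      have hy := add_le_sum (fun k _ => (hposy k).le) (mem_univ i) (mem_univ j) hij
      have := hposx i
      have := hposx j
      have := hposy i
      have := hposy j
      constructor <;> linarith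
    · intro i j _
      norm_num
    · exact fun i => ⟨hbx i, le_rfl, hby i, le_rfl⟩
    · intro i j _
      norm_num
    · intro i j _
      simp
    · simp
  · rintro v ⟨cx, cy, lx, ly, dx, dy, zx, zy, -, hcut, rfl⟩
    refine Finset.sum_le_sum fun q hq => ?_
    exact mul_le_mul_of_nonneg_left (hcut _ _ (Finset.mem_filter.1 hq).2.ne) (hpnn _ _)
end

section
/- Under the 1D-FLP data, define c¹ i = ℓ i + 2 * ∑_{j < i} ℓ j for each i ∈ Fin N (sum over indices j with j < i in the order of Fin N), d¹ i j = |c¹ j - c¹ i| for all i, j, and z¹ i j = 1 if i < j and z¹ i j = 0 otherwise (for i ≠ j). Then (c¹, d¹, z¹) belongs to the 1D-FLP feasible set Q₁. In particular Q₁ is nonempty. -/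
open Finset

/-- In a left-justified layout, the right end of component `i` is at most `2 * ∑ j ∈ s, ℓ j` for
any `s` containing all indices up to `i`. -/
theorem left_justified_right_end_le {N : ℕ} {ℓ : Fin N → ℝ} (hℓ : ∀ i, 0 ≤ ℓ i)
    {s : Finset (Fin N)} {i : Fin N} (hs : ∀ j ≤ i, j ∈ s) :
    ℓ i + 2 * ∑ j ∈ Finset.univ.filter (fun j => j < i), ℓ j + ℓ i ≤ 2 * ∑ j ∈ s, ℓ j := by
  have hsub : insert i (Finset.univ.filter (fun j => j < i)) ⊆ s := by
    intro j hj
    simp only [mem_insert, mem_filter, mem_univ, true_and] at hj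
    exact hs j (hj.elim le_of_eq le_of_lt)
  have hle := Finset.sum_le_sum_of_subset_of_nonneg hsub (fun j _ _ => hℓ j)
  rw [Finset.sum_insert (by simp)] at hle
  linarith

/-- the left-justified layout in index order is feasible for the 1D-FLP. -/
theorem left_justified_layout_feasible {N : ℕ} (hN : 2 ≤ N)
    (ℓ : Fin N → ℝ) (hℓ : ∀ i, 0 < ℓ i)
    (L : ℝ) (hL : L ≥ 2 * ∑ i, ℓ i)
    (c₁ : Fin N → ℝ)
    (hc₁ : ∀ i, c₁ i = ℓ i + 2 * ∑ j ∈ Finset.univ.filter (fun j => j < i), ℓ j)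
    (d₁ : Fin N → Fin N → ℝ) (hd₁ : ∀ i j, d₁ i j = |c₁ j - c₁ i|)
    (z₁ : Fin N → Fin N → ℝ) (hz₁ : ∀ i j, z₁ i j = if i < j then 1 else 0) :
    Mem1D ℓ L Finset.univ c₁ d₁ z₁ ∧
    ∃ c d z, Mem1D ℓ L Finset.univ c d z := by
  have hleft : ∀ i, ℓ i ≤ c₁ i := fun i => by
    rw [hc₁]
    linarith [Finset.sum_nonneg (s := Finset.univ.filter (fun j => j < i))
      (fun j _ => (hℓ j).le)]
  have hright : ∀ i, c₁ i + ℓ i ≤ L := fun i => by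
    rw [hc₁]
    exact (left_justified_right_end_le (fun j => (hℓ j).le) fun j _ => mem_univ j).trans hL
  have hsep : ∀ i j, i < j → c₁ i + ℓ i ≤ c₁ j - ℓ j := fun i j hij => by
    rw [hc₁ i, hc₁ j, add_sub_cancel_left]
    exact left_justified_right_end_le (fun k => (hℓ k).le) fun k hk => by
      simpa using hk.trans_lt hij
  have hmem : Mem1D ℓ L Finset.univ c₁ d₁ z₁ := by
    refine ⟨fun i _ j _ _ => ?_, fun i _ j _ _ => ?_, fun i _ j _ hij => ?_,
      fun i _ j _ hij => ?_, fun i _ => ⟨?_, ?_⟩, fun i _ j _ _ => ?_⟩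
    · rw [hd₁, hd₁, abs_sub_comm]
    · rw [hd₁, abs_sub_comm]
      exact le_abs_self _
    · rw [hz₁]
      split_ifs with h
      · linarith [hsep i j h]
      · linarith [hright i, hleft j]
    · rcases hij.lt_or_gt with h | h <;> simp [hz₁, h, h.not_gt]
    · exact (hℓ i).le.trans (hleft i)
    · linarith [hright i, hℓ i]
    · rw [hz₁]
      split_ifs <;> simp
  exact ⟨hmem, c₁, d₁, z₁, hmem⟩
end

section
/- Let N ≥ 2 and let I be the index type Option {q : Fin N × Fin N // q.1 ≠ q.2}. Define the symmetric matrix M : Matrix I I ℝ by: M none none = 1; M none (some (i, j)) = M (some (i, j)) none = 1/2 for every ordered pair (i, j) with i ≠ j; M (some (i, j)) (some (i, j)) = 1/2; M (some (i, j)) (some (j, i)) = 0 for i ≠ j; and M (some (i, j)) (some (r, s)) = 1/4 for all remaining pairs of indices (i.e. (i, j) ≠ (r, s) and (i, j) ≠ (s, r)). Then M is positive semidefinite. -/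
/-- The moment matrix of the candidate solution `ẑ_{ij} = 1/2`,
`ŷ(z_{ij}, z_{rs}) = 1/2` if `(i,j) = (r,s)`, `0` if `(i,j) = (s,r)`, and `1/4` otherwise,
arising in the proof of Proposition 4.2.  The index `none` corresponds to `∅` and
`some ⟨(i, j), _⟩` to the ordered pair `(i, j)` with `i ≠ j`. -/
noncomputable def momentMatrix (N : ℕ) :
    Matrix (Option {q : Fin N × Fin N // q.1 ≠ q.2})
      (Option {q : Fin N × Fin N // q.1 ≠ q.2}) ℝ :=
  fun I J =>
    match I, J with
    | none, none => 1
    | none, some _ => 1 / 2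
    | some _, none => 1 / 2
    | some q, some r =>
      if q = r then 1 / 2
      else if q.1.1 = r.1.2 ∧ q.1.2 = r.1.1 then 0
      else 1 / 4

/-- The transposition `(i, j) ↦ (j, i)` on ordered pairs of distinct elements. -/
def offDiagSwap {α : Type*} (q : {q : α × α // q.1 ≠ q.2}) : {q : α × α // q.1 ≠ q.2} :=
  ⟨q.1.swap, q.2.symm⟩

lemma offDiagSwap_ne {α : Type*} (q : {q : α × α // q.1 ≠ q.2}) : offDiagSwap q ≠ q :=
  fun h => q.2 (congrArg (fun r => r.1.2) h)

lemma offDiagSwap_involutive {α : Type*} :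
    Function.Involutive (offDiagSwap : {q : α × α // q.1 ≠ q.2} → _) :=
  fun _ => rfl

lemma eq_offDiagSwap_iff {α : Type*} (q r : {q : α × α // q.1 ≠ q.2}) :
    q = offDiagSwap r ↔ q.1.1 = r.1.2 ∧ q.1.2 = r.1.1 := by
  rw [Subtype.ext_iff, Prod.ext_iff]
  rfl

/-- The matrix whose column at `q` is the difference of the unit vectors at `q` and at its swap. -/
def swapDifference (N : ℕ) :
    Matrix (Option {q : Fin N × Fin N // q.1 ≠ q.2}) {q : Fin N × Fin N // q.1 ≠ q.2} ℝ :=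
  fun I r => I.elim 0 fun q => (if q = r then 1 else 0) - (if offDiagSwap q = r then 1 else 0)

open Matrix in
lemma momentMatrix_eq_vecMulVec_add (N : ℕ) :
    momentMatrix N =
      vecMulVec (fun I => I.elim 1 fun _ => 1 / 2) (star fun I => I.elim 1 fun _ => 1 / 2) +
        (1 / 8 : ℝ) • (swapDifference N * (swapDifference N)ᴴ) := by
  ext I J
  rcases I with _ | q <;> rcases J with _ | r
  · simp [momentMatrix, vecMulVec_apply, mul_apply, swapDifference]
  · simp [momentMatrix, vecMulVec_apply, mul_apply, swapDifference]
  · simp [momentMatrix, vecMulVec_apply, mul_apply, swapDifference]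
  · simp only [momentMatrix, ← eq_offDiagSwap_iff]
    have hqr : offDiagSwap r = q ↔ q = offDiagSwap r := eq_comm
    have hrq : r = offDiagSwap q ↔ q = offDiagSwap r := by
      rw [← offDiagSwap_involutive.eq_iff, hqr]
    by_cases h : q = r
    · subst h
      simp [vecMulVec_apply, mul_apply, swapDifference, sub_mul,
        Finset.sum_sub_distrib, offDiagSwap_ne, (offDiagSwap_ne _).symm]
      norm_num
    · by_cases h' : q = offDiagSwap r
      · subst h'
        simp [vecMulVec_apply, mul_apply, swapDifference, sub_mul, Finset.sum_sub_distrib,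
          offDiagSwap_involutive r, offDiagSwap_ne, (offDiagSwap_ne _).symm]
        norm_num
      · simp [vecMulVec_apply, mul_apply, swapDifference, sub_mul, Finset.sum_sub_distrib,
          offDiagSwap_involutive.injective.eq_iff, h, Ne.symm h, hqr, hrq, h']
        norm_num

/-- the moment matrix is positive semidefinite. -/
theorem momentMatrix_posSemidef (N : ℕ) (hN : 2 ≤ N) :
    (momentMatrix N).PosSemidef := by
  rw [momentMatrix_eq_vecMulVec_add]
  exact (Matrix.posSemidef_vecMulVec_self_star _).add
    ((Matrix.posSemidef_self_mul_conjTranspose _).smul (by norm_num))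
end
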